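/- There exists a universal constant c > 0 such that for every ε > 0, setting C_ε := c·‖η_ε‖_{L^{6/5}(ℝ³)}, the following holds: for all smooth compactly supported divergence-free vector fields u, v, ρ : ℝ³ → ℝ³, |b(η_ε ∗ u, u, ρ) − b(η_ε ∗ v, v, ρ)| ≤ 2 C_ε (‖u‖_{H¹} + ‖v‖_{H¹}) ‖ρ‖_{H¹} ‖u − v‖_{H¹}^{1/2} ‖u − v‖_{L²}^{1/2}, where ‖f‖_{H¹} := (‖f‖_{L²}² + ‖∇f‖_{L²}²)^{1/2}. -/

import Mathlib

open MeasureTheory Filter Topology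

noncomputable section

/-- ℝ³ with the Euclidean norm. -/
abbrev V3 : Type := EuclideanSpace ℝ (Fin 3)

/-- The standard mollifier: `η(x) = C·exp(1/(|x|²−1))` for `|x| < 1`, `0` otherwise. -/
def eta (C : ℝ) (x : V3) : ℝ :=
  if ‖x‖ < 1 then C * Real.exp (1 / (‖x‖ ^ 2 - 1)) else 0

/-- The rescaled mollifier `η_ε(x) = ε⁻³ η(x/ε)`. -/
def etaEps (C ε : ℝ) (x : V3) : ℝ := ε⁻¹ ^ 3 * eta C (ε⁻¹ • x)

/-- The mollification `k_ε f = η_ε ∗ f` of a scalar function `f`. -/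
def mollify (C ε : ℝ) (f : V3 → ℝ) : V3 → ℝ :=
  convolution (etaEps C ε) f (ContinuousLinearMap.mul ℝ ℝ) volume

/-- `∂ v_j / ∂ x_i` at `x`. -/
def partialD (i j : Fin 3) (v : V3 → V3) (x : V3) : ℝ :=
  fderiv ℝ v x (EuclideanSpace.single i 1) j

/-- The trilinear form `b(u,v,w) = ∑_{i,j} ∫ u_i ∂v_j/∂x_i w_j dx`. -/
def bform (u v w : V3 → V3) : ℝ :=
  ∑ i : Fin 3, ∑ j : Fin 3, ∫ x : V3, u x i * partialD i j v x * w x j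

/-- The divergence `div u = ∑ i, ∂u_i/∂x_i`. -/
def divg (u : V3 → V3) (x : V3) : ℝ := ∑ i : Fin 3, partialD i i u x

/-- `i`-th component of the componentwise mollification `η_ε ∗ u` of a vector field. -/
def mollifyComp (C ε : ℝ) (u : V3 → V3) (i : Fin 3) : V3 → ℝ :=
  mollify C ε (fun y => u y i)

/-- The trilinear form `b(η_ε ∗ u, v, w)` with mollified first argument. -/
def bMol (C ε : ℝ) (u v w : V3 → V3) : ℝ :=
  ∑ i : Fin 3, ∑ j : Fin 3, ∫ x : V3, mollifyComp C ε u i x * partialD i j v x * w x j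

/-- The `L^p` norm (w.r.t. Lebesgue measure) of a scalar function. -/
def lpNorm (p : ℝ) (g : V3 → ℝ) : ℝ := (∫ x : V3, |g x| ^ p) ^ (1 / p)

/-- The `L^p` norm of a vector field (L^p norm of the pointwise Euclidean norm). -/
def vecLp (p : ℝ) (u : V3 → V3) : ℝ := lpNorm p (fun x => ‖u x‖)

/-- Pointwise Euclidean norm of the mollified vector field `η_ε ∗ u`. -/
def molNorm (C ε : ℝ) (u : V3 → V3) (x : V3) : ℝ :=
  Real.sqrt (∑ i : Fin 3, (mollifyComp C ε u i x) ^ 2)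

/-- `L^p` norm of the mollified vector field `η_ε ∗ u`. -/
def molLp (p C ε : ℝ) (u : V3 → V3) : ℝ := lpNorm p (molNorm C ε u)

/-- Pointwise Frobenius norm of the derivative matrix `(∂v_j/∂x_i)_{i,j}`. -/
def gradNorm (v : V3 → V3) (x : V3) : ℝ :=
  Real.sqrt (∑ i : Fin 3, ∑ j : Fin 3, (partialD i j v x) ^ 2)

/-- `‖∇v‖_{L²}`, the `L²` norm of the pointwise Frobenius norm of the derivative. -/
def gradL2 (v : V3 → V3) : ℝ := lpNorm 2 (gradNorm v)

/-- The `H¹` norm `(‖f‖_{L²}² + ‖∇f‖_{L²}²)^{1/2}` of a vector field. -/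
def h1Norm (u : V3 → V3) : ℝ := Real.sqrt ((vecLp 2 u) ^ 2 + (gradL2 u) ^ 2)


open scoped ENNReal NNReal

lemma lintegral_translate_mul {f g : V3 → ℝ≥0∞} (hf : Measurable f) (hg : Measurable g) :
    ∫⁻ z : V3 × V3, f z.2 * g (z.1 - z.2) = (∫⁻ x, f x) * ∫⁻ x, g x := by
  rw [Measure.volume_eq_prod, lintegral_prod_symm' _ (by fun_prop)]
  have : ∀ y : V3, ∫⁻ x : V3, f y * g (x - y) = f y * ∫⁻ x, g x := fun y => by
    rw [lintegral_const_mul _ (by fun_prop), lintegral_sub_right_eq_self]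
  simp_rw [this]
  exact lintegral_mul_const _ hf

lemma lintegral_mul_translate {f g : V3 → ℝ≥0∞} (hf : Measurable f) (hg : Measurable g) :
    ∫⁻ z : V3 × V3, f z.1 * g (z.1 - z.2) = (∫⁻ x, f x) * ∫⁻ x, g x := by
  rw [Measure.volume_eq_prod, lintegral_prod _ (by fun_prop)]
  have : ∀ x : V3, ∫⁻ y : V3, f x * g (x - y) = f x * ∫⁻ y, g y := fun x => by
    rw [lintegral_const_mul _ (by fun_prop), lintegral_sub_left_eq_self]
  simp_rw [this]
  exact lintegral_mul_const _ hf

lemma lintegral_mul_convolution_eq {k a G r : V3 → ℝ≥0∞} (hk : Measurable k) (ha : Measurable a)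
    (hG : Measurable G) (hr : Measurable r) :
    ∫⁻ x, (∫⁻ t, k t * a (x - t)) * G x * r x
      = ∫⁻ z : V3 × V3, k z.2 * a (z.1 - z.2) * G z.1 * r z.1 := by
  rw [Measure.volume_eq_prod, lintegral_prod _ (by fun_prop)]
  refine lintegral_congr fun x => ?_
  rw [← lintegral_mul_const _ (by fun_prop), ← lintegral_mul_const _ (by fun_prop)]

lemma lintegral_rpow_mul_rpow_mul_rpow_le {f g h : V3 × V3 → ℝ≥0∞} (hf : Measurable f)
    (hg : Measurable g) (hh : Measurable h) {p q r : ℝ} (hp : 0 ≤ p) (hq : 0 ≤ q) (hr : 0 ≤ r)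
    (hpqr : p + q + r = 1) :
    ∫⁻ z, f z ^ p * g z ^ q * h z ^ r
      ≤ (∫⁻ z, f z) ^ p * (∫⁻ z, g z) ^ q * (∫⁻ z, h z) ^ r := by
  have := ENNReal.lintegral_prod_norm_pow_le (μ := (volume : Measure (V3 × V3)))
    (Finset.univ : Finset (Fin 3)) (f := ![f, g, h]) (p := ![p, q, r])
    (by intro i _; fin_cases i <;> simp <;> fun_prop)
    (by simp [Fin.sum_univ_three, hpqr])
    (by intro i _; fin_cases i <;> simp [hp, hq, hr])
  simpa [Fin.prod_univ_three] using this

lemma ennreal_rpow_eq_mul (s : ℝ≥0∞) {p q r : ℝ} (hp : 0 ≤ p) (hq : 0 ≤ q) (h : p + q = r) :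
    s ^ r = s ^ p * s ^ q := by
  rw [← h, ENNReal.rpow_add_of_nonneg _ _ hp hq]

lemma ennreal_eq_rpow_mul_rpow (s : ℝ≥0∞) {p q : ℝ} (hp : 0 ≤ p) (hq : 0 ≤ q) (h : p + q = 1) :
    s = s ^ p * s ^ q := by
  rw [← ennreal_rpow_eq_mul s hp hq h, ENNReal.rpow_one]

/-- Trilinear Young–Hölder inequality with the convolved factor in `L²`. -/
lemma lintegral_convolution_mul_mul_le_two_two_six {k a G r : V3 → ℝ≥0∞} (hk : Measurable k)
    (ha : Measurable a) (hG : Measurable G) (hr : Measurable r) :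
    ∫⁻ x, (∫⁻ t, k t * a (x - t)) * G x * r x ≤
      (∫⁻ x, k x ^ (6 / 5 : ℝ)) ^ (5 / 6 : ℝ) * (∫⁻ x, a x ^ (2 : ℝ)) ^ (1 / 2 : ℝ) *
        (∫⁻ x, G x ^ (2 : ℝ)) ^ (1 / 2 : ℝ) * (∫⁻ x, r x ^ (6 : ℝ)) ^ (1 / 6 : ℝ) := by
  rw [lintegral_mul_convolution_eq hk ha hG hr]
  have key := lintegral_rpow_mul_rpow_mul_rpow_le
    (f := fun z => k z.2 ^ (6 / 5 : ℝ) * a (z.1 - z.2) ^ (2 : ℝ))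
    (g := fun z => G z.1 ^ (2 : ℝ) * k z.2 ^ (6 / 5 : ℝ))
    (h := fun z => r z.1 ^ (6 : ℝ) * a (z.1 - z.2) ^ (2 : ℝ))
    (by fun_prop) (by fun_prop) (by fun_prop) (p := 1 / 3) (q := 1 / 2) (r := 1 / 6)
    (by norm_num) (by norm_num) (by norm_num) (by norm_num)
  rw [lintegral_translate_mul (f := fun x => k x ^ (6 / 5 : ℝ)) (g := fun x => a x ^ (2 : ℝ))
      (by fun_prop) (by fun_prop),
    lintegral_mul_translate (f := fun x => r x ^ (6 : ℝ)) (g := fun x => a x ^ (2 : ℝ))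
      (by fun_prop) (by fun_prop), Measure.volume_eq_prod,
    lintegral_prod_mul (f := fun x => G x ^ (2 : ℝ)) (g := fun x => k x ^ (6 / 5 : ℝ))
      (by fun_prop) (by fun_prop)] at key
  rw [Measure.volume_eq_prod]
  refine le_trans (le_of_eq (lintegral_congr fun z => ?_)) (key.trans (le_of_eq ?_))
  · simp only [ENNReal.mul_rpow_of_nonneg _ _ (show (0 : ℝ) ≤ 1 / 3 by norm_num),
      ENNReal.mul_rpow_of_nonneg _ _ (show (0 : ℝ) ≤ 1 / 2 by norm_num),
      ENNReal.mul_rpow_of_nonneg _ _ (show (0 : ℝ) ≤ 1 / 6 by norm_num), ← ENNReal.rpow_mul]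
    norm_num
    nth_rewrite 1 [ennreal_eq_rpow_mul_rpow (k z.2) (p := 2 / 5) (q := 3 / 5) (by norm_num)
        (by norm_num) (by norm_num),
      ennreal_eq_rpow_mul_rpow (a (z.1 - z.2)) (p := 2 / 3) (q := 1 / 3) (by norm_num)
        (by norm_num) (by norm_num)]
    ring
  · simp only [ENNReal.mul_rpow_of_nonneg _ _ (show (0 : ℝ) ≤ 1 / 3 by norm_num),
      ENNReal.mul_rpow_of_nonneg _ _ (show (0 : ℝ) ≤ 1 / 2 by norm_num),
      ENNReal.mul_rpow_of_nonneg _ _ (show (0 : ℝ) ≤ 1 / 6 by norm_num)]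
    rw [ennreal_rpow_eq_mul (∫⁻ x, k x ^ (6 / 5 : ℝ)) (p := 1 / 3) (q := 1 / 2) (r := 5 / 6)
        (by norm_num) (by norm_num) (by norm_num),
      ennreal_rpow_eq_mul (∫⁻ x, a x ^ (2 : ℝ)) (p := 1 / 3) (q := 1 / 6) (r := 1 / 2)
        (by norm_num) (by norm_num) (by norm_num)]
    ring

/-- Trilinear Young–Hölder inequality with the convolved factor in `L⁶`. -/
lemma lintegral_convolution_mul_mul_le_six_two_two {k a G r : V3 → ℝ≥0∞} (hk : Measurable k)
    (ha : Measurable a) (hG : Measurable G) (hr : Measurable r) :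
    ∫⁻ x, (∫⁻ t, k t * a (x - t)) * G x * r x ≤
      (∫⁻ x, k x ^ (6 / 5 : ℝ)) ^ (5 / 6 : ℝ) * (∫⁻ x, a x ^ (6 : ℝ)) ^ (1 / 6 : ℝ) *
        (∫⁻ x, G x ^ (2 : ℝ)) ^ (1 / 2 : ℝ) * (∫⁻ x, r x ^ (2 : ℝ)) ^ (1 / 2 : ℝ) := by
  rw [lintegral_mul_convolution_eq hk ha hG hr]
  have key := lintegral_rpow_mul_rpow_mul_rpow_le
    (f := fun z => r z.1 ^ (2 : ℝ) * k z.2 ^ (6 / 5 : ℝ))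
    (g := fun z => G z.1 ^ (2 : ℝ) * k z.2 ^ (6 / 5 : ℝ))
    (h := fun z => r z.1 ^ (2 : ℝ) * a (z.1 - z.2) ^ (6 : ℝ))
    (by fun_prop) (by fun_prop) (by fun_prop) (p := 1 / 3) (q := 1 / 2) (r := 1 / 6)
    (by norm_num) (by norm_num) (by norm_num) (by norm_num)
  rw [lintegral_mul_translate (f := fun x => r x ^ (2 : ℝ)) (g := fun x => a x ^ (6 : ℝ))
      (by fun_prop) (by fun_prop), Measure.volume_eq_prod,
    lintegral_prod_mul (f := fun x => G x ^ (2 : ℝ)) (g := fun x => k x ^ (6 / 5 : ℝ))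
      (by fun_prop) (by fun_prop),
    lintegral_prod_mul (f := fun x => r x ^ (2 : ℝ)) (g := fun x => k x ^ (6 / 5 : ℝ))
      (by fun_prop) (by fun_prop)] at key
  rw [Measure.volume_eq_prod]
  refine le_trans (le_of_eq (lintegral_congr fun z => ?_)) (key.trans (le_of_eq ?_))
  · simp only [ENNReal.mul_rpow_of_nonneg _ _ (show (0 : ℝ) ≤ 1 / 3 by norm_num),
      ENNReal.mul_rpow_of_nonneg _ _ (show (0 : ℝ) ≤ 1 / 2 by norm_num),
      ENNReal.mul_rpow_of_nonneg _ _ (show (0 : ℝ) ≤ 1 / 6 by norm_num), ← ENNReal.rpow_mul]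
    norm_num
    nth_rewrite 1 [ennreal_eq_rpow_mul_rpow (k z.2) (p := 2 / 5) (q := 3 / 5) (by norm_num)
        (by norm_num) (by norm_num),
      ennreal_eq_rpow_mul_rpow (r z.1) (p := 2 / 3) (q := 1 / 3) (by norm_num)
        (by norm_num) (by norm_num)]
    ring
  · simp only [ENNReal.mul_rpow_of_nonneg _ _ (show (0 : ℝ) ≤ 1 / 3 by norm_num),
      ENNReal.mul_rpow_of_nonneg _ _ (show (0 : ℝ) ≤ 1 / 2 by norm_num),
      ENNReal.mul_rpow_of_nonneg _ _ (show (0 : ℝ) ≤ 1 / 6 by norm_num)]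
    rw [ennreal_rpow_eq_mul (∫⁻ x, k x ^ (6 / 5 : ℝ)) (p := 1 / 3) (q := 1 / 2) (r := 5 / 6)
        (by norm_num) (by norm_num) (by norm_num),
      ennreal_rpow_eq_mul (∫⁻ x, r x ^ (2 : ℝ)) (p := 1 / 3) (q := 1 / 6) (r := 1 / 2)
        (by norm_num) (by norm_num) (by norm_num)]
    ring

lemma lintegral_rpow_eq_ofReal_lpNorm {f : V3 → ℝ} {p : ℝ} (hp : 0 < p)
    (hf : Integrable fun x => |f x| ^ p) :
    (∫⁻ x, ‖f x‖ₑ ^ p) ^ (1 / p) = ENNReal.ofReal (_root_.lpNorm p f) := by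
  have h0 : 0 ≤ ∫ x, |f x| ^ p := integral_nonneg fun x => by positivity
  rw [_root_.lpNorm, ← ENNReal.ofReal_rpow_of_nonneg h0 (by positivity),
    ofReal_integral_eq_lintegral_ofReal hf (Eventually.of_forall fun x => by positivity)]
  congr 2
  ext x
  rw [← ENNReal.ofReal_rpow_of_nonneg (abs_nonneg _) hp.le, ← Real.enorm_eq_ofReal_abs]

lemma lpNorm_nonneg (p : ℝ) (f : V3 → ℝ) : 0 ≤ _root_.lpNorm p f :=
  Real.rpow_nonneg (integral_nonneg fun x => by positivity) _

lemma integrable_abs_rpow {f : V3 → ℝ} (hf : Continuous f) (hs : HasCompactSupport f) {p : ℝ}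
    (hp : 0 < p) : Integrable fun x => |f x| ^ p :=
  (hf.abs.rpow_const fun _ => Or.inr hp.le).integrable_of_hasCompactSupport
    (hs.comp_left (g := fun t : ℝ => |t| ^ p) (by simp [hp.ne']))

lemma integrable_etaEps {C ε : ℝ} (hC : Integrable (eta C)) (hε : 0 < ε) :
    Integrable (etaEps C ε) :=
  (hC.comp_smul (inv_ne_zero hε.ne')).const_mul _

lemma measurable_etaEps (C ε : ℝ) : Measurable (etaEps C ε) := by
  have : Measurable (eta C) :=
    Measurable.ite (measurableSet_lt (by fun_prop) (by fun_prop)) (by fun_prop) (by fun_prop)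
  unfold etaEps
  fun_prop

lemma abs_eta_le {C : ℝ} (hC : 0 < C) (x : V3) : |eta C x| ≤ C := by
  unfold eta
  split_ifs with h
  · rw [abs_of_nonneg (by positivity)]
    refine mul_le_of_le_one_right hC.le (Real.exp_le_one_iff.2 ?_)
    exact one_div_nonpos.2 (by nlinarith [norm_nonneg x])
  · simpa using hC.le

lemma integrable_etaEps_rpow {C ε : ℝ} (hC : 0 < C) (hint : Integrable (eta C)) (hε : 0 < ε) :
    Integrable fun x => |etaEps C ε x| ^ (6 / 5 : ℝ) := by
  refine ((integrable_etaEps hint hε).abs.const_mul ((ε⁻¹ ^ 3 * C) ^ (1 / 5 : ℝ))).mono'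
    (((measurable_etaEps C ε).abs.pow_const _).aestronglyMeasurable)
    (Eventually.of_forall fun x => ?_)
  have hb : |etaEps C ε x| ≤ ε⁻¹ ^ 3 * C := by
    rw [etaEps, abs_mul, abs_of_pos (by positivity : 0 < ε⁻¹ ^ 3)]
    gcongr
    exact abs_eta_le hC _
  rw [Real.norm_of_nonneg (by positivity), show (6 / 5 : ℝ) = 1 / 5 + 1 by norm_num,
    Real.rpow_add_of_nonneg (abs_nonneg _) (by norm_num) (by norm_num), Real.rpow_one]
  gcongr

lemma hasCompactSupport_coord {u : V3 → V3} (hu : HasCompactSupport u) (j : Fin 3) :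
    HasCompactSupport fun x => u x j :=
  hu.comp_left (g := fun y : V3 => y j) rfl

lemma contDiff_coord {n : WithTop ℕ∞} {u : V3 → V3} (hu : ContDiff ℝ n u) (j : Fin 3) :
    ContDiff ℝ n fun x => u x j :=
  (EuclideanSpace.proj (𝕜 := ℝ) j).contDiff.comp hu

lemma fderiv_coord {u : V3 → V3} (hu : ContDiff ℝ 1 u) (j : Fin 3) (x e : V3) :
    fderiv ℝ (fun y => u y j) x e = fderiv ℝ u x e j := by
  have := ((EuclideanSpace.proj (𝕜 := ℝ) j).hasFDerivAt.comp x
    (hu.differentiable one_ne_zero x).hasFDerivAt).fderiv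
  exact congrArg (fun T : V3 →L[ℝ] ℝ => T e) this

lemma partialD_eq_fderiv {u : V3 → V3} (hu : ContDiff ℝ 1 u) (i j : Fin 3) :
    partialD i j u = fun x => fderiv ℝ (fun y => u y j) x (EuclideanSpace.single i 1) :=
  funext fun x => (fderiv_coord hu j x _).symm

lemma continuous_partialD {u : V3 → V3} (hu : ContDiff ℝ 1 u) (i j : Fin 3) :
    Continuous (partialD i j u) := by
  rw [partialD_eq_fderiv hu]
  exact ((contDiff_coord hu j).continuous_fderiv one_ne_zero).clm_apply continuous_const

lemma hasCompactSupport_partialD {u : V3 → V3} (hs : HasCompactSupport u) (i j : Fin 3) :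
    HasCompactSupport (partialD i j u) :=
  (hs.fderiv ℝ).comp_left (g := fun T : V3 →L[ℝ] V3 => T (EuclideanSpace.single i 1) j) rfl

lemma continuous_gradNorm {u : V3 → V3} (hu : ContDiff ℝ 1 u) : Continuous (gradNorm u) := by
  have := fun i j => continuous_partialD hu i j
  unfold gradNorm
  fun_prop

lemma hasCompactSupport_gradNorm {u : V3 → V3} (hs : HasCompactSupport u) :
    HasCompactSupport (gradNorm u) :=
  (hs.fderiv ℝ).comp_left (g := fun T : V3 →L[ℝ] V3 =>
    Real.sqrt (∑ i : Fin 3, ∑ j : Fin 3, (T (EuclideanSpace.single i 1) j) ^ 2)) (by simp)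

lemma abs_partialD_le_gradNorm (u : V3 → V3) (i j : Fin 3) (x : V3) :
    |partialD i j u x| ≤ gradNorm u x := by
  refine Real.abs_le_sqrt ?_
  refine le_trans ?_ (Finset.single_le_sum (f := fun i => ∑ j : Fin 3, (partialD i j u x) ^ 2)
    (fun i _ => Finset.sum_nonneg fun j _ => sq_nonneg _) (Finset.mem_univ i))
  exact Finset.single_le_sum (f := fun j => (partialD i j u x) ^ 2)
    (fun j _ => sq_nonneg _) (Finset.mem_univ j)

lemma norm_fderiv_le_gradNorm (u : V3 → V3) (x : V3) : ‖fderiv ℝ u x‖ ≤ gradNorm u x := by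
  refine ContinuousLinearMap.opNorm_le_bound _ (Real.sqrt_nonneg _) fun y => ?_
  have hy : y = ∑ i : Fin 3, y i • (EuclideanSpace.single i (1 : ℝ) : V3) := by
    ext k; simp [Pi.single_apply]
  have hnorm : ∀ z : V3, ‖z‖ = Real.sqrt (∑ j : Fin 3, z j ^ 2) := fun z => by
    simp [EuclideanSpace.norm_eq]
  calc ‖fderiv ℝ u x y‖
      = ‖∑ i : Fin 3, y i • fderiv ℝ u x (EuclideanSpace.single i 1)‖ := by
        conv_lhs => rw [hy]
        simp only [map_sum, map_smul]
    _ ≤ ∑ i : Fin 3, |y i| * ‖fderiv ℝ u x (EuclideanSpace.single i 1)‖ :=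
        (norm_sum_le _ _).trans (le_of_eq (by simp [norm_smul]))
    _ ≤ Real.sqrt (∑ i : Fin 3, |y i| ^ 2) *
          Real.sqrt (∑ i : Fin 3, ‖fderiv ℝ u x (EuclideanSpace.single i 1)‖ ^ 2) :=
        Real.sum_mul_le_sqrt_mul_sqrt _ _ _
    _ = gradNorm u x * ‖y‖ := by
        rw [mul_comm, hnorm y, gradNorm]
        congr 2
        · refine congrArg _ (funext fun i => ?_)
          rw [hnorm, Real.sq_sqrt (Finset.sum_nonneg fun j _ => sq_nonneg _)]
          rfl
        · simp

/-- The Sobolev inequality `‖u‖_{L⁶} ≤ K ‖∇u‖_{L²}` on `ℝ³`. -/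
lemma exists_sobolev_const : ∃ K : ℝ≥0, ∀ u : V3 → V3, ContDiff ℝ 1 u → HasCompactSupport u →
    (∫⁻ x, ‖u x‖ₑ ^ (6 : ℝ)) ^ (1 / 6 : ℝ) ≤ K * ENNReal.ofReal (gradL2 u) := by
  refine ⟨eLpNormLESNormFDerivOfEqInnerConst (volume : Measure V3) 2, fun u hu hs => ?_⟩
  have h := eLpNorm_le_eLpNorm_fderiv_of_eq_inner (volume : Measure V3) hu hs
    (p := 2) (p' := 6) (by norm_num) (by simp) (by simp; norm_num)
  rw [eLpNorm_nnreal_eq_lintegral (by norm_num), eLpNorm_nnreal_eq_lintegral (by norm_num)] at h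
  simp only [NNReal.coe_ofNat] at h
  refine h.trans ?_
  gcongr
  rw [gradL2, ← lintegral_rpow_eq_ofReal_lpNorm two_pos
    (integrable_abs_rpow (continuous_gradNorm hu) (hasCompactSupport_gradNorm hs) two_pos)]
  gcongr with x
  exact enorm_le_iff_norm_le.2 ((norm_fderiv_le_gradNorm u x).trans (le_abs_self _))

lemma contDiff_mollifyComp {C ε : ℝ} (hk : Integrable (etaEps C ε)) {u : V3 → V3}
    (hu : ContDiff ℝ 1 u) (hs : HasCompactSupport u) (i : Fin 3) :
    ContDiff ℝ 1 (mollifyComp C ε u i) :=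
  (hasCompactSupport_coord hs i).contDiff_convolution_right _ hk.locallyIntegrable
    (contDiff_coord hu i)

lemma fderiv_mollifyComp {C ε : ℝ} (hk : Integrable (etaEps C ε)) {u : V3 → V3}
    (hu : ContDiff ℝ 1 u) (hs : HasCompactSupport u) (i j : Fin 3) (x : V3) :
    fderiv ℝ (mollifyComp C ε u j) x (EuclideanSpace.single i 1)
      = mollify C ε (partialD i j u) x := by
  have hc := contDiff_coord hu j
  have hcs := hasCompactSupport_coord hs j
  rw [mollifyComp, mollify, (hcs.hasFDerivAt_convolution_right _ hk.locallyIntegrable hc x).fderiv,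
    convolution_precompR_apply _ hk.locallyIntegrable (hcs.fderiv ℝ)
      (hc.continuous_fderiv one_ne_zero), mollify, partialD_eq_fderiv hu]

lemma sum_fderiv_mollifyComp_eq_zero {C ε : ℝ} (hk : Integrable (etaEps C ε)) {u : V3 → V3}
    (hu : ContDiff ℝ 1 u) (hs : HasCompactSupport u) (hdiv : ∀ x, divg u x = 0) (x : V3) :
    ∑ i : Fin 3, fderiv ℝ (mollifyComp C ε u i) x (EuclideanSpace.single i 1) = 0 := by
  simp only [fderiv_mollifyComp hk hu hs, mollify, convolution_def]
  rw [← integral_finsetSum]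
  · simp only [← map_sum]
    refine integral_eq_zero_of_ae (Eventually.of_forall fun t => ?_)
    have := hdiv (x - t)
    rw [divg] at this
    simp [this]
  · intro i _
    exact (hasCompactSupport_partialD hs i i).convolutionExists_right
      (ContinuousLinearMap.mul ℝ ℝ) hk.locallyIntegrable (continuous_partialD hu i i) x

lemma mollifyComp_sub {C ε : ℝ} (hk : Integrable (etaEps C ε)) {u v : V3 → V3}
    (hu : Continuous u) (hus : HasCompactSupport u) (hv : Continuous v)
    (hvs : HasCompactSupport v) (i : Fin 3) (x : V3) :
    mollifyComp C ε (fun y => u y - v y) i x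
      = mollifyComp C ε u i x - mollifyComp C ε v i x := by
  have hex : ∀ f : V3 → V3, Continuous f → HasCompactSupport f →
      ConvolutionExistsAt (etaEps C ε) (fun y => f y i) x (ContinuousLinearMap.mul ℝ ℝ) volume :=
    fun f hf hfs => (hasCompactSupport_coord hfs i).convolutionExists_right _ hk.locallyIntegrable
      (by fun_prop) x
  simp only [mollifyComp, mollify, convolution_def]
  rw [← integral_sub (hex u hu hus) (hex v hv hvs)]
  simp [mul_sub]

lemma partialD_sub {u v : V3 → V3} (hu : ContDiff ℝ 1 u) (hv : ContDiff ℝ 1 v) (i j : Fin 3)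
    (x : V3) : partialD i j (fun y => u y - v y) x = partialD i j u x - partialD i j v x := by
  simp only [partialD]
  rw [fderiv_fun_sub (hu.differentiable one_ne_zero x) (hv.differentiable one_ne_zero x)]
  simp

lemma integrable_mollifyComp_mul_partialD_mul {C ε : ℝ} (hk : Integrable (etaEps C ε))
    {u v w : V3 → V3} (hu : ContDiff ℝ 1 u) (hus : HasCompactSupport u) (hv : ContDiff ℝ 1 v)
    (hw : Continuous w) (hws : HasCompactSupport w) (i j : Fin 3) :
    Integrable fun x => mollifyComp C ε u i x * partialD i j v x * w x j := by
  have h1 := (contDiff_mollifyComp hk hu hus i).continuous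
  have h2 := continuous_partialD hv i j
  exact Continuous.integrable_of_hasCompactSupport (by fun_prop)
    (hasCompactSupport_coord hws j).mul_left

/-- Antisymmetry of `b(η_ε ∗ u, ·, ·)` for a divergence-free field `u`. -/
lemma bMol_antisymm {C ε : ℝ} (hk : Integrable (etaEps C ε)) {u v w : V3 → V3}
    (hu : ContDiff ℝ 1 u) (hus : HasCompactSupport u) (hdiv : ∀ x, divg u x = 0)
    (hv : ContDiff ℝ 1 v) (hvs : HasCompactSupport v) (hw : ContDiff ℝ 1 w)
    (hws : HasCompactSupport w) : bMol C ε u v w = -bMol C ε u w v := by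
  set a : Fin 3 → V3 → ℝ := mollifyComp C ε u with ha
  have hac : ∀ i, ContDiff ℝ 1 (a i) := contDiff_mollifyComp hk hu hus
  have hda : ∀ i, Continuous fun x => fderiv ℝ (a i) x (EuclideanSpace.single i 1) := fun i =>
    ((hac i).continuous_fderiv one_ne_zero).clm_apply continuous_const
  have hI : ∀ i j, Integrable fun x =>
      fderiv ℝ (a i) x (EuclideanSpace.single i 1) * (v x j * w x j) := fun i j => by
    have h1 := hda i
    have h2 := hv.continuous
    have h3 := hw.continuous
    exact Continuous.integrable_of_hasCompactSupport (by fun_prop)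
      (hasCompactSupport_coord hws j).mul_left.mul_left
  have parts : ∀ i j, (∫ x, a i x * partialD i j v x * w x j) + ∫ x, a i x * partialD i j w x * v x j
      = -∫ x, fderiv ℝ (a i) x (EuclideanSpace.single i 1) * (v x j * w x j) := by
    intro i j
    have hv' := contDiff_coord hv j
    have hw' := contDiff_coord hw j
    have hvw : ContDiff ℝ 1 fun x => v x j * w x j := hv'.mul hw'
    have hac' := (hac i).continuous
    have hsum := (integrable_mollifyComp_mul_partialD_mul hk hu hus hv hw.continuous hws i j).add
      (integrable_mollifyComp_mul_partialD_mul hk hu hus hw hv.continuous hvs i j)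
    have heq : ∀ x, a i x * fderiv ℝ (fun x => v x j * w x j) x (EuclideanSpace.single i 1)
        = a i x * partialD i j v x * w x j + a i x * partialD i j w x * v x j := by
      intro x
      rw [fderiv_fun_mul (hv'.differentiable one_ne_zero x) (hw'.differentiable one_ne_zero x),
        partialD_eq_fderiv hv, partialD_eq_fderiv hw]
      simp
      ring
    rw [← integral_add (integrable_mollifyComp_mul_partialD_mul hk hu hus hv hw.continuous hws i j)
      (integrable_mollifyComp_mul_partialD_mul hk hu hus hw hv.continuous hvs i j)]
    refine (integral_congr_ae (Eventually.of_forall fun x => (heq x).symm)).trans ?_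
    refine integral_mul_fderiv_eq_neg_fderiv_mul_of_integrable (hI i j) ?_ ?_
      (fun x _ => (hac i).differentiable one_ne_zero x)
      (fun x _ => hvw.differentiable one_ne_zero x)
    · simp only [heq]
      exact hsum
    · have h2 := hvw.continuous
      exact Continuous.integrable_of_hasCompactSupport (by fun_prop)
        (hasCompactSupport_coord hws j).mul_left.mul_left
  rw [eq_neg_iff_add_eq_zero]
  simp only [bMol, ← Finset.sum_add_distrib]
  simp only [← ha, parts, Finset.sum_neg_distrib, neg_eq_zero]
  rw [Finset.sum_comm]
  refine Finset.sum_eq_zero fun j _ => ?_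
  rw [← integral_finsetSum _ fun i _ => hI i j]
  simp only [← Finset.sum_mul, ha, sum_fderiv_mollifyComp_eq_zero hk hu hus hdiv, zero_mul,
    integral_zero]

lemma bMol_sub_bMol {C ε : ℝ} (hk : Integrable (etaEps C ε)) {u v w : V3 → V3}
    (hu : ContDiff ℝ 1 u) (hus : HasCompactSupport u) (hv : ContDiff ℝ 1 v)
    (hvs : HasCompactSupport v) (hw : Continuous w) (hws : HasCompactSupport w) :
    bMol C ε u u w - bMol C ε v v w
      = bMol C ε (fun x => u x - v x) u w + bMol C ε v (fun x => u x - v x) w := by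
  have hd : ContDiff ℝ 1 fun x => u x - v x := hu.sub hv
  have hds : HasCompactSupport fun x => u x - v x := hus.sub hvs
  simp only [bMol, ← Finset.sum_add_distrib, ← Finset.sum_sub_distrib]
  refine Finset.sum_congr rfl fun i _ => Finset.sum_congr rfl fun j _ => ?_
  rw [← integral_sub (integrable_mollifyComp_mul_partialD_mul hk hu hus hu hw hws i j)
      (integrable_mollifyComp_mul_partialD_mul hk hv hvs hv hw hws i j),
    ← integral_add (integrable_mollifyComp_mul_partialD_mul hk hd hds hu hw hws i j)
      (integrable_mollifyComp_mul_partialD_mul hk hv hvs hd hw hws i j)]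
  refine integral_congr_ae (Eventually.of_forall fun x => ?_)
  simp only [mollifyComp_sub hk hu.continuous hus hv.continuous hvs, partialD_sub hu hv]
  ring

lemma enorm_mollifyComp_le (C ε : ℝ) (u : V3 → V3) (i : Fin 3) (x : V3) :
    ‖mollifyComp C ε u i x‖ₑ ≤ ∫⁻ t, ‖etaEps C ε t‖ₑ * ‖u (x - t)‖ₑ := by
  refine (enorm_integral_le_lintegral_enorm _).trans (lintegral_mono fun t => ?_)
  rw [ContinuousLinearMap.mul_apply', enorm_mul]
  gcongr
  exact enorm_le_iff_norm_le.2 (PiLp.norm_apply_le _ i)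

lemma enorm_bMol_le (C ε : ℝ) (u v w : V3 → V3) :
    ‖bMol C ε u v w‖ₑ ≤
      9 * ∫⁻ x, (∫⁻ t, ‖etaEps C ε t‖ₑ * ‖u (x - t)‖ₑ) * ‖gradNorm v x‖ₑ * ‖w x‖ₑ := by
  have h : ∀ i j, ‖∫ x, mollifyComp C ε u i x * partialD i j v x * w x j‖ₑ ≤
      ∫⁻ x, (∫⁻ t, ‖etaEps C ε t‖ₑ * ‖u (x - t)‖ₑ) * ‖gradNorm v x‖ₑ * ‖w x‖ₑ := fun i j => by
    refine (enorm_integral_le_lintegral_enorm _).trans (lintegral_mono fun x => ?_)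
    rw [enorm_mul, enorm_mul]
    gcongr
    · exact enorm_mollifyComp_le C ε u i x
    · exact enorm_le_iff_norm_le.2 ((abs_partialD_le_gradNorm v i j x).trans (le_abs_self _))
    · exact enorm_le_iff_norm_le.2 (PiLp.norm_apply_le _ j)
  refine (enorm_sum_le _ _).trans ((Finset.sum_le_sum fun i _ => (enorm_sum_le _ _).trans
    (Finset.sum_le_sum fun j _ => h i j)).trans (le_of_eq ?_))
  simp only [Finset.sum_const, Finset.card_univ, Fintype.card_fin, nsmul_eq_mul, ← mul_assoc]
  norm_num

lemma lintegral_enorm_sq_eq_vecLp {u : V3 → V3} (hu : Continuous u) (hs : HasCompactSupport u) :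
    (∫⁻ x, ‖u x‖ₑ ^ (2 : ℝ)) ^ (1 / 2 : ℝ) = ENNReal.ofReal (vecLp 2 u) := by
  rw [vecLp, ← lintegral_rpow_eq_ofReal_lpNorm two_pos
    (integrable_abs_rpow hu.norm hs.norm two_pos)]
  simp only [enorm_norm]

lemma lintegral_enorm_gradNorm_sq_eq_gradL2 {u : V3 → V3} (hu : ContDiff ℝ 1 u)
    (hs : HasCompactSupport u) :
    (∫⁻ x, ‖gradNorm u x‖ₑ ^ (2 : ℝ)) ^ (1 / 2 : ℝ) = ENNReal.ofReal (gradL2 u) := by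
  rw [gradL2, ← lintegral_rpow_eq_ofReal_lpNorm two_pos
    (integrable_abs_rpow (continuous_gradNorm hu) (hasCompactSupport_gradNorm hs) two_pos)]

lemma vecLp_le_h1Norm (u : V3 → V3) : vecLp 2 u ≤ h1Norm u :=
  Real.le_sqrt_of_sq_le (le_add_of_nonneg_right (sq_nonneg _))

lemma gradL2_le_h1Norm (u : V3 → V3) : gradL2 u ≤ h1Norm u :=
  Real.le_sqrt_of_sq_le (le_add_of_nonneg_left (sq_nonneg _))

/-- The two trilinear bounds for `b(η_ε ∗ u, v, w)`, with `u` or `w` measured in `L²`. -/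
lemma exists_abs_bMol_le {C : ℝ} (hC : 0 < C) (hint : Integrable (eta C)) :
    ∃ K : ℝ, 0 ≤ K ∧ ∀ ε : ℝ, 0 < ε → ∀ u v w : V3 → V3,
      ContDiff ℝ 1 u → HasCompactSupport u → ContDiff ℝ 1 v → HasCompactSupport v →
      ContDiff ℝ 1 w → HasCompactSupport w →
      |bMol C ε u v w| ≤
        K * _root_.lpNorm (6 / 5) (etaEps C ε) * vecLp 2 u * gradL2 v * gradL2 w ∧
      |bMol C ε u v w| ≤
        K * _root_.lpNorm (6 / 5) (etaEps C ε) * gradL2 u * gradL2 v * vecLp 2 w := by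
  obtain ⟨K, hK⟩ := exists_sobolev_const
  refine ⟨9 * K, by positivity, fun ε hε u v w hu hus hv hvs hw hws => ?_⟩
  have hN := lintegral_rpow_eq_ofReal_lpNorm (by norm_num) (integrable_etaEps_rpow hC hint hε)
  have hN0 := lpNorm_nonneg (6 / 5) (etaEps C ε)
  have hL0 : ∀ f, 0 ≤ vecLp 2 f := fun f => lpNorm_nonneg _ _
  have hG0 : ∀ f, 0 ≤ gradL2 f := fun f => lpNorm_nonneg _ _
  rw [show (1 / (6 / 5) : ℝ) = 5 / 6 by norm_num] at hN
  have hk : Measurable fun t => ‖etaEps C ε t‖ₑ := (measurable_etaEps C ε).enorm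
  have hcu : Measurable fun t => ‖u t‖ₑ := hu.continuous.measurable.enorm
  have hcw : Measurable fun t => ‖w t‖ₑ := hw.continuous.measurable.enorm
  have hcv : Measurable fun t => ‖gradNorm v t‖ₑ := (continuous_gradNorm hv).measurable.enorm
  have hK' : (K : ℝ≥0∞) = ENNReal.ofReal K := (ENNReal.ofReal_coe_nnreal).symm
  have h9 : (9 : ℝ≥0∞) = ENNReal.ofReal 9 := by simp
  constructor
  · rw [← ENNReal.ofReal_le_ofReal_iff (by have := hL0 u; have := hG0 v; have := hG0 w; positivity),
      ← Real.enorm_eq_ofReal_abs]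
    refine (enorm_bMol_le C ε u v w).trans ?_
    refine (mul_le_mul_right (lintegral_convolution_mul_mul_le_two_two_six hk hcu hcv hcw) _).trans ?_
    rw [hN, lintegral_enorm_sq_eq_vecLp hu.continuous hus,
      lintegral_enorm_gradNorm_sq_eq_gradL2 hv hvs]
    refine (mul_le_mul_right (mul_le_mul_right (hK w hw hws) _) _).trans (le_of_eq ?_)
    have := hL0 u; have := hG0 v; have := hG0 w
    rw [hK', h9, ← ENNReal.ofReal_mul (by positivity), ← ENNReal.ofReal_mul (by positivity),
      ← ENNReal.ofReal_mul (by positivity), ← ENNReal.ofReal_mul (by positivity),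
      ← ENNReal.ofReal_mul (by positivity)]
    ring_nf
  · rw [← ENNReal.ofReal_le_ofReal_iff (by have := hG0 u; have := hG0 v; have := hL0 w; positivity),
      ← Real.enorm_eq_ofReal_abs]
    refine (enorm_bMol_le C ε u v w).trans ?_
    refine (mul_le_mul_right (lintegral_convolution_mul_mul_le_six_two_two hk hcu hcv hcw) _).trans ?_
    rw [hN, lintegral_enorm_sq_eq_vecLp hw.continuous hws,
      lintegral_enorm_gradNorm_sq_eq_gradL2 hv hvs]
    refine (mul_le_mul_right (mul_le_mul_left (mul_le_mul_left (mul_le_mul_right (hK u hu hus) _) _)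
      _) _).trans (le_of_eq ?_)
    have := hG0 u; have := hG0 v; have := hL0 w
    rw [hK', h9, ← ENNReal.ofReal_mul (by positivity), ← ENNReal.ofReal_mul (by positivity),
      ← ENNReal.ofReal_mul (by positivity), ← ENNReal.ofReal_mul (by positivity),
      ← ENNReal.ofReal_mul (by positivity)]
    ring_nf

/-- there is a universal constant `c > 0` such that for every `ε > 0`, with
`C_ε = c·‖η_ε‖_{L^{6/5}}`, for all smooth compactly supported divergence-free fields `u, v, ρ`:
`|b(η_ε∗u,u,ρ) − b(η_ε∗v,v,ρ)| ≤ 2C_ε (‖u‖_{H¹}+‖v‖_{H¹}) ‖ρ‖_{H¹} ‖u−v‖_{H¹}^{1/2} ‖u−v‖_{L²}^{1/2}`. -/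
theorem stmt12 (C : ℝ) (hC : 0 < C) (hnorm : ∫ x : V3, eta C x = 1) :
    ∃ c : ℝ, 0 < c ∧ ∀ ε : ℝ, 0 < ε → ∀ u v ρ : V3 → V3,
      ContDiff ℝ (⊤ : ℕ∞) u → HasCompactSupport u → (∀ x, divg u x = 0) →
      ContDiff ℝ (⊤ : ℕ∞) v → HasCompactSupport v → (∀ x, divg v x = 0) →
      ContDiff ℝ (⊤ : ℕ∞) ρ → HasCompactSupport ρ → (∀ x, divg ρ x = 0) →
      |bMol C ε u u ρ - bMol C ε v v ρ| ≤
        2 * (c * lpNorm (6 / 5) (etaEps C ε)) * (h1Norm u + h1Norm v) * h1Norm ρ *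
          (h1Norm (fun x => u x - v x)) ^ ((1 : ℝ) / 2) *
          (vecLp 2 (fun x => u x - v x)) ^ ((1 : ℝ) / 2) := by
  have hint : Integrable (eta C) := integrable_of_integral_eq_one hnorm
  obtain ⟨K, hK0, hK⟩ := exists_abs_bMol_le hC hint
  refine ⟨K + 1, by positivity, fun ε hε u v ρ hu hus _ hv hvs hvd hρ hρs _ => ?_⟩
  have hk := integrable_etaEps hint hε
  replace hu : ContDiff ℝ 1 u := hu.of_le (by exact_mod_cast le_top)
  replace hv : ContDiff ℝ 1 v := hv.of_le (by exact_mod_cast le_top)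
  replace hρ : ContDiff ℝ 1 ρ := hρ.of_le (by exact_mod_cast le_top)
  rw [bMol_sub_bMol hk hu hus hv hvs hρ.continuous hρs]
  set w : V3 → V3 := fun x => u x - v x
  have hw : ContDiff ℝ 1 w := hu.sub hv
  have hws : HasCompactSupport w := hus.sub hvs
  rw [bMol_antisymm hk hv hvs hvd hw hws hρ hρs]
  have h1 := (hK ε hε w u ρ hw hws hu hus hρ hρs).1
  have h2 := (hK ε hε v ρ w hv hvs hρ hρs hw hws).2
  set N := _root_.lpNorm (6 / 5) (etaEps C ε)
  have hN0 : 0 ≤ N := lpNorm_nonneg _ _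
  have hL0 : 0 ≤ vecLp 2 w := lpNorm_nonneg _ _
  have hG0 : ∀ f, 0 ≤ gradL2 f := fun f => lpNorm_nonneg _ _
  have hH0 : ∀ f, 0 ≤ h1Norm f := fun f => Real.sqrt_nonneg _
  have hu0 := hH0 u
  have hv0 := hH0 v
  have hρ0 := hH0 ρ
  have hu1 := gradL2_le_h1Norm u
  have hv1 := gradL2_le_h1Norm v
  have hρ1 := gradL2_le_h1Norm ρ
  have hgu := hG0 u
  have hgρ := hG0 ρ
  have interp : vecLp 2 w ≤ h1Norm w ^ (1 / 2 : ℝ) * vecLp 2 w ^ (1 / 2 : ℝ) := by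
    calc vecLp 2 w = vecLp 2 w ^ (1 / 2 : ℝ) * vecLp 2 w ^ (1 / 2 : ℝ) := by
          rw [← Real.rpow_add_of_nonneg hL0 (by norm_num) (by norm_num)]; norm_num
      _ ≤ _ := by gcongr; exact vecLp_le_h1Norm w
  calc |bMol C ε w u ρ + -bMol C ε v ρ w|
      ≤ |bMol C ε w u ρ| + |bMol C ε v ρ w| := (abs_add_le _ _).trans_eq (by rw [abs_neg])
    _ ≤ K * N * vecLp 2 w * h1Norm u * h1Norm ρ + K * N * h1Norm v * h1Norm ρ * vecLp 2 w := by
        refine add_le_add (h1.trans ?_) (h2.trans ?_) <;> gcongr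
    _ = K * N * (h1Norm u + h1Norm v) * h1Norm ρ * vecLp 2 w := by ring
    _ ≤ (2 * (K + 1)) * N * (h1Norm u + h1Norm v) * h1Norm ρ *
          (h1Norm w ^ (1 / 2 : ℝ) * vecLp 2 w ^ (1 / 2 : ℝ)) := by
        gcongr
        linarith
    _ = _ := by ring
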